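/- The curve 𝒞 : U² = 3(T⁴ − 54T² − 117T − 243) has no ℚ-rational points: there exist no u, t ∈ ℚ with u² = 3(t⁴ − 54t² − 117t − 243). -/

import Mathlib

theorem Zsqrtd.exists_reduction_of_norm_eq_cube {k a b x : ℤ} (hab : IsCoprime a b) (hx : x ≠ 0)
    (h : a ^ 2 - k * b ^ 2 = x ^ 3) :
    ∃ r c : ℤ, r ^ 2 - x * c = k ∧ ∀ X Y : ℤ, ∃ γ δ : ℤ√k, γ ^ 3 = ⟨a, b⟩ * δ ∧
      δ.re ^ 2 - k * δ.im ^ 2 = (x * X ^ 2 + 2 * r * X * Y + c * Y ^ 2) ^ 3 := by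
  have hbx : IsCoprime b (x ^ 3) := by
    rw [← h]
    have : IsCoprime b (a ^ 2 + b * (-k * b)) := hab.symm.pow_right.add_mul_left_right _
    convert this using 1; ring
  obtain ⟨s, t, hst⟩ := hbx
  set q : ℤ := s ^ 2 + k * (-2 * t + t ^ 2 * x ^ 3) with hq
  have hx3 : x ^ 3 ≠ 0 := pow_ne_zero _ hx
  have hr : (a * s) ^ 2 - k = x ^ 3 * q := by
    rw [hq]
    linear_combination s ^ 2 * h + k * (s * b + 1 - t * x ^ 3) * hst
  refine ⟨a * s, x ^ 2 * q, by linear_combination hr, fun X Y => ?_⟩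
  set r := a * s with hrdef
  have key : ∃ δ : ℤ√k, (⟨x * X + r * Y, Y⟩ : ℤ√k) ^ 3 = ⟨a, b⟩ * δ := by
    have hk : (⟨r, 1⟩ * ⟨r, -1⟩ : ℤ√k) = (x : ℤ√k) ^ 3 * (q : ℤ√k) := by
      rw [← Int.cast_pow, ← Int.cast_mul, ← hr]
      ext <;> simp [-Int.cast_pow, -Int.cast_sub, -Int.cast_mul] ; ring
    have hn : (⟨a, b⟩ * ⟨a, -b⟩ : ℤ√k) = (x : ℤ√k) ^ 3 := by
      rw [← Int.cast_pow, ← h]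
      ext <;> simp [-Int.cast_pow, -Int.cast_sub, -Int.cast_mul] <;> ring
    have hγ : (⟨x * X + r * Y, Y⟩ : ℤ√k) = (x : ℤ√k) * X + Y * ⟨r, 1⟩ := by
      ext <;> simp ; ring
    have ha : (⟨a, -b⟩ : ℤ√k) = (b : ℤ√k) * ⟨r, -1⟩ + a * t * (x : ℤ√k) ^ 3 := by
      have : (a : ℤ√k) * t * (x : ℤ√k) ^ 3 = ((a * t * x ^ 3 : ℤ) : ℤ√k) := by push_cast; ring
      rw [this]
      ext
      · simp [-Int.cast_pow, -Int.cast_sub, -Int.cast_mul]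
        linear_combination -a * hst
      · simp [-Int.cast_pow, -Int.cast_sub, -Int.cast_mul]
    set ρ : ℤ√k := ⟨r, 1⟩
    set ρ' : ℤ√k := ⟨r, -1⟩
    set γ : ℤ√k := ⟨x * X + r * Y, Y⟩
    set α : ℤ√k := ⟨a, b⟩
    set α' : ℤ√k := ⟨a, -b⟩
    let δ : ℤ√k := b * (X ^ 3 * ρ' + 3 * x ^ 2 * X ^ 2 * Y * q + 3 * x * X * Y ^ 2 * q * ρ
      + Y ^ 3 * q * ρ ^ 2) + a * t * γ ^ 3
    have hδ : α' * γ ^ 3 = (x : ℤ√k) ^ 3 * δ := by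
      simp only [δ]
      rw [ha, hγ]
      linear_combination (b * (3 * x ^ 2 * X ^ 2 * Y + 3 * x * X * Y ^ 2 * ρ + Y ^ 3 * ρ ^ 2)) * hk
    have h3 : (x : ℤ√k) ^ 3 * γ ^ 3 = (x : ℤ√k) ^ 3 * (α * δ) := by
      linear_combination -γ ^ 3 * hn + α * hδ
    refine ⟨δ, ?_⟩
    rw [← Int.cast_pow] at h3
    exact Zsqrtd.eq_of_smul_eq_smul_left hx3 h3
  obtain ⟨δ, hδ⟩ := key
  refine ⟨_, δ, hδ, ?_⟩
  have hN := congrArg Zsqrtd.norm hδ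
  rw [pow_succ, pow_two, Zsqrtd.norm_mul, Zsqrtd.norm_mul, Zsqrtd.norm_mul] at hN
  simp only [Zsqrtd.norm_def] at hN
  apply mul_left_cancel₀ hx3
  rw [← h]
  have e : (x * X + r * Y) ^ 2 - k * Y ^ 2 =
      x * (x * X ^ 2 + 2 * r * X * Y + x ^ 2 * q * Y ^ 2) := by
    linear_combination Y ^ 2 * hr
  have e3 := congrArg (· ^ 3) e
  rw [mul_pow, ← h] at e3
  linear_combination -hN + e3

theorem exists_small_value_of_disc_neg (a b c : ℤ) (ha : 0 < a) (h : b ^ 2 - a * c = -1221) :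
    ∃ X Y : ℤ, a * X ^ 2 + 2 * b * X * Y + c * Y ^ 2 ∈
      ({1, 2, 3, 5, 6, 7, 10, 11, 13, 14, 15, 21, 22, 26, 30, 31, 33, 35, 37, 39, 78} :
        Finset ℤ) := by
  induction hn : a.toNat using Nat.strong_induction_on generalizing a b c with
  | _ n ih =>
  subst hn
  obtain ⟨e, b', hb, h1, h2⟩ : ∃ e b' : ℤ, b = b' + a * e ∧ -a ≤ 2 * b' ∧ 2 * b' ≤ a := by
    refine ⟨(2 * b + a) / (2 * a), b - a * ((2 * b + a) / (2 * a)), by ring, ?_, ?_⟩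
    · have := Int.mul_ediv_self_le (x := 2 * b + a) (k := 2 * a) (by positivity)
      linarith
    · have := Int.lt_mul_ediv_self_add (x := 2 * b + a) (k := 2 * a) (by positivity)
      linarith
  set c' := c - 2 * b' * e - a * e ^ 2 with hc'
  have h' : b' ^ 2 - a * c' = -1221 := by
    rw [hc', ← h, hb]; ring
  suffices H : ∃ X Y : ℤ, a * X ^ 2 + 2 * b' * X * Y + c' * Y ^ 2 ∈
      ({1, 2, 3, 5, 6, 7, 10, 11, 13, 14, 15, 21, 22, 26, 30, 31, 33, 35, 37, 39, 78} :
        Finset ℤ) by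
    obtain ⟨X, Y, H⟩ := H
    refine ⟨X - e * Y, Y, ?_⟩
    convert H using 1
    rw [hc', hb]; ring
  by_cases hle : a ≤ 40
  · by_cases h25 : a = 25
    · subst h25
      have : b' = 2 ∨ b' = -2 := by
        have : -12 ≤ b' := by omega
        have : b' ≤ 12 := by omega
        interval_cases b' <;> omega
      rcases this with rfl | rfl
      · exact ⟨1, 1, by simp; omega⟩
      · exact ⟨1, -1, by simp; omega⟩
    · refine ⟨1, 0, ?_⟩
      simp only [one_pow, mul_one, mul_zero, add_zero, ne_eq, OfNat.ofNat_ne_zero,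
        not_false_eq_true, zero_pow]
      have : -20 ≤ b' := by omega
      have : b' ≤ 20 := by omega
      interval_cases a <;> first | decide | (exfalso; interval_cases b' <;> omega)
  · have hc0 : 0 < c' := by
      by_contra hc
      nlinarith [sq_nonneg b', mul_nonneg ha.le (not_lt.mp hc |> neg_nonneg.mpr)]
    have hlt : c' < a := by
      by_contra hc
      nlinarith [mul_nonneg (sub_nonneg.2 h1) (sub_nonneg.2 h2),
        mul_le_mul_of_nonneg_left (not_lt.mp hc) ha.le]
    obtain ⟨X, Y, H⟩ := ih c'.toNat (by omega) c' b' a hc0 (by linarith) rfl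
    refine ⟨Y, X, ?_⟩
    convert H using 1
    ring
theorem eq_one_of_sq_add_eq_cube {A s t : ℤ} (hA : A ∈
      ({1, 2, 3, 5, 6, 7, 10, 11, 13, 14, 15, 21, 22, 26, 30, 31, 33, 35, 37, 39, 78} :
        Finset ℤ)) (h : s ^ 2 + 1221 * t ^ 2 = A ^ 3) : (s = 1 ∨ s = -1) ∧ t = 0 := by
  have hsq : IsSquare (A ^ 3 - 1221 * |t| ^ 2) := ⟨s, by rw [sq_abs]; linarith⟩
  have hle : 1221 * |t| ^ 2 ≤ A ^ 3 := by rw [sq_abs]; nlinarith [sq_nonneg s]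
  have h0 : 0 ≤ |t| := abs_nonneg t
  rw [← abs_eq_zero]
  rw [← sq_abs t] at h
  generalize |t| = T at *
  have hT : T < 20 := by
    have : A ≤ 78 := by clear h hsq hle; revert A; decide
    have : 0 ≤ A := by clear h hsq hle; revert A; decide
    have : A ^ 3 ≤ 78 ^ 3 := by gcongr
    nlinarith
  simp only [Finset.mem_insert, Finset.mem_singleton] at hA
  rcases hA with rfl | rfl | rfl | rfl | rfl | rfl | rfl | rfl | rfl | rfl | rfl | rfl | rfl |
    rfl | rfl | rfl | rfl | rfl | rfl | rfl | rfl
  · have : T = 0 := by nlinarith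
    subst this
    exact ⟨sq_eq_sq_iff_eq_or_eq_neg.1 (show s ^ 2 = 1 ^ 2 by linarith), rfl⟩
  all_goals
    exfalso
    clear h
    interval_cases T <;> first | (norm_num at hle; done) | norm_num at hsq

theorem exists_small_value_of_disc_pos (a b c : ℤ) (h : b ^ 2 - a * c = 407) :
    ∃ X Y : ℤ, a * X ^ 2 + 2 * b * X * Y + c * Y ^ 2 ∈ ({1, -1, 2, -2} : Finset ℤ) := by
  induction hn : a.natAbs using Nat.strong_induction_on generalizing a b c with
  | _ n ih =>
  subst hn
  have ha : a ≠ 0 := by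
    rintro rfl
    have h1 : b < 21 := by nlinarith
    have h2 : -21 < b := by nlinarith
    interval_cases b <;> omega
  obtain ⟨e, b', hb, h1, h2⟩ : ∃ e b' : ℤ, b = b' + a * e ∧ -|a| ≤ 2 * b' ∧ 2 * b' ≤ |a| := by
    have hpos : 0 < 2 * |a| := by positivity
    have e1 := Int.mul_ediv_self_le (x := 2 * b + |a|) (k := 2 * |a|) hpos.ne'
    have e2 := Int.lt_mul_ediv_self_add (x := 2 * b + |a|) (k := 2 * |a|) hpos
    refine ⟨a.sign * ((2 * b + |a|) / (2 * |a|)), b - |a| * ((2 * b + |a|) / (2 * |a|)),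
      ?_, by linarith, by linarith⟩
    rw [← mul_assoc, Int.mul_sign_self, Int.natCast_natAbs]; ring
  set c' := c - 2 * b' * e - a * e ^ 2 with hc'
  have h' : b' ^ 2 - a * c' = 407 := by
    rw [hc', ← h, hb]; ring
  suffices H : ∃ X Y : ℤ,
      a * X ^ 2 + 2 * b' * X * Y + c' * Y ^ 2 ∈ ({1, -1, 2, -2} : Finset ℤ) by
    obtain ⟨X, Y, H⟩ := H
    refine ⟨X - e * Y, Y, ?_⟩
    convert H using 1
    rw [hc', hb]; ring
  by_cases hle : |a| ≤ 20
  · have ha1 := (abs_le.1 hle).1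
    have ha2 := (abs_le.1 hle).2
    have hb1 : -10 ≤ b' := by omega
    have hb2 : b' ≤ 10 := by omega
    clear_value c'
    clear ih hc' hb h
    have hXY : ∀ X Y : ℤ, a * X ^ 2 + 2 * b' * X * Y + c' * Y ^ 2 = 1 ∨
        a * X ^ 2 + 2 * b' * X * Y + c' * Y ^ 2 = -1 ∨
        a * X ^ 2 + 2 * b' * X * Y + c' * Y ^ 2 = 2 ∨
        a * X ^ 2 + 2 * b' * X * Y + c' * Y ^ 2 = -2 → ∃ X Y : ℤ,
        a * X ^ 2 + 2 * b' * X * Y + c' * Y ^ 2 ∈ ({1, -1, 2, -2} : Finset ℤ) :=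
      fun X Y H => ⟨X, Y, by simpa using H⟩
    rcases abs_cases a with ⟨ha3, ha4⟩ | ⟨ha3, ha4⟩ <;> rw [ha3] at h1 h2 hle <;> clear ha3
    all_goals interval_cases a <;> first | exact absurd rfl ha | skip
    all_goals
      interval_cases b' <;> first
        | (exfalso; omega)
        | exact hXY 1 0 (by omega)
        | exact hXY 1 1 (by omega)
        | exact hXY 1 (-1) (by omega)
        | exact hXY 3 1 (by omega)
        | exact hXY 3 (-1) (by omega)
        | exact hXY 3 2 (by omega)
        | exact hXY 3 (-2) (by omega)
        | exact hXY 7 5 (by omega)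
        | exact hXY 7 (-5) (by omega)
        | exact hXY 11 6 (by omega)
  · have hlt : |c'| < |a| := by
      by_contra hc
      have e1 : |a| * |c'| = |b' ^ 2 - 407| := by rw [← abs_mul]; congr 1; linarith
      have e3 : 21 ≤ |a| := by linarith [Int.add_one_le_iff.2 (not_le.1 hle)]
      rcases abs_cases (b' ^ 2 - 407) with ⟨e2, -⟩ | ⟨e2, -⟩ <;> rw [e2] at e1 <;>
      nlinarith [mul_nonneg (sub_nonneg.2 h1) (sub_nonneg.2 h2),
        mul_le_mul e3 e3 (by simp) (by simp), sq_nonneg b',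
        mul_le_mul_of_nonneg_left (not_lt.mp hc) (abs_nonneg a)]
    obtain ⟨X, Y, H⟩ := ih c'.natAbs (by zify; exact hlt) c' b' a (by linarith) rfl
    refine ⟨Y, X, ?_⟩
    convert H using 1
    ring

theorem isFundamental_pell_407 :
    Pell.IsFundamental (Pell.Solution₁.mk 2663 132 (by norm_num) : Pell.Solution₁ 407) := by
  refine ⟨by simp, by simp, fun {a} ha => ?_⟩
  rw [Pell.Solution₁.x_mk]
  by_contra! hlt
  have hp := a.prop
  have hsq : IsSquare (1 + 407 * |a.y| ^ 2) := ⟨a.x, by rw [sq_abs]; linarith⟩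
  have h0 : 0 < |a.y| := abs_pos.2 (Pell.Solution₁.y_ne_zero_of_one_lt_x ha)
  have h1 : |a.y| < 132 := by
    rw [← sq_abs a.y] at hp
    nlinarith
  generalize |a.y| = T at *
  clear hp hlt ha
  interval_cases T <;> norm_num at hsq

theorem exists_eq_cube_of_sq_add_eq_cube {a b x : ℤ} (hab : IsCoprime a b)
    (h : a ^ 2 + 1221 * b ^ 2 = x ^ 3) :
    ∃ m n : ℤ, a = m ^ 3 - 3663 * m * n ^ 2 ∧ b = 3 * m ^ 2 * n - 1221 * n ^ 3 := by
  have hx : 0 < x := by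
    have : 0 < x ^ 3 := by
      rw [← h]
      rcases hab.ne_zero_or_ne_zero with h0 | h0 <;> positivity
    exact (Odd.pow_pos_iff (by decide)).1 this
  obtain ⟨r, c, hrc, H⟩ := Zsqrtd.exists_reduction_of_norm_eq_cube (k := -1221) hab hx.ne'
    (by linarith)
  obtain ⟨X, Y, hA⟩ := exists_small_value_of_disc_neg x r c hx hrc
  obtain ⟨⟨m, n⟩, ⟨s, t⟩, h1, h2⟩ := H X Y
  obtain ⟨hs, rfl⟩ := eq_one_of_sq_add_eq_cube hA (s := s) (t := t) (by simpa using h2)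
  have e1 := congrArg Zsqrtd.re h1
  have e2 := congrArg Zsqrtd.im h1
  simp [pow_succ] at e1 e2
  rcases hs with rfl | rfl
  · exact ⟨m, n, by linarith, by linarith⟩
  · exact ⟨-m, -n, by linarith, by linarith⟩

theorem eq_one_of_sq_sub_eq_cube {A s t : ℤ} (hA : A ∈ ({1, -1, 2, -2} : Finset ℤ))
    (h : s ^ 2 - 407 * t ^ 2 = A ^ 3) : s ^ 2 - 407 * t ^ 2 = 1 := by
  have h11 : (s : ZMod 11) ^ 2 = A ^ 3 := by
    have := congrArg (Int.cast : ℤ → ZMod 11) h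
    push_cast at this
    rwa [show (407 : ZMod 11) = 0 from rfl, zero_mul, sub_zero] at this
  have h37 : (s : ZMod 37) ^ 2 = A ^ 3 := by
    have := congrArg (Int.cast : ℤ → ZMod 37) h
    push_cast at this
    rwa [show (407 : ZMod 37) = 0 from rfl, zero_mul, sub_zero] at this
  generalize (s : ZMod 11) = s₁ at h11
  generalize (s : ZMod 37) = s₂ at h37
  simp only [Finset.mem_insert, Finset.mem_singleton] at hA
  rcases hA with rfl | rfl | rfl | rfl
  · simpa using h
  · exfalso; push_cast at h11; revert s₁; decide
  · exfalso; push_cast at h11; revert s₁; decide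
  · exfalso; push_cast at h37; revert s₂; decide

theorem exists_eq_cube_mul_of_sq_sub_eq_cube {a b x : ℤ} (hab : IsCoprime a b) (hx : x ≠ 0)
    (h : a ^ 2 - 407 * b ^ 2 = x ^ 3) :
    ∃ g : ℤ√407, ∃ η ∈ ({⟨1, 0⟩, ⟨2663, 132⟩, ⟨2663, -132⟩} : Set (ℤ√407)),
      (⟨a, b⟩ : ℤ√407) = g ^ 3 * η := by
  obtain ⟨r, c, hrc, H⟩ := Zsqrtd.exists_reduction_of_norm_eq_cube hab hx h
  obtain ⟨X, Y, hA⟩ := exists_small_value_of_disc_pos x r c hrc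
  obtain ⟨γ, ⟨s, t⟩, h1, h2⟩ := H X Y
  have hst := eq_one_of_sq_sub_eq_cube hA h2
  let f : Pell.Solution₁ 407 →* ℤ√407 :=
    { toFun := fun u => ⟨u.x, u.y⟩
      map_one' := rfl
      map_mul' := fun u v => by ext <;> simp; ring }
  set ε : Pell.Solution₁ 407 := Pell.Solution₁.mk 2663 132 (by norm_num)
  have hu : f (Pell.Solution₁.mk s t hst) = ⟨s, t⟩ := rfl
  rw [← hu] at h1
  generalize Pell.Solution₁.mk s t hst = u at h1
  have hfneg : ∀ v, f (-v) = -f v := fun v =>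
    Zsqrtd.ext (Pell.Solution₁.x_neg v) (Pell.Solution₁.y_neg v)
  obtain ⟨σ, n, hσ, hn⟩ : ∃ σ : ℤ√407, ∃ n : ℤ, σ ^ 2 = 1 ∧ f u = σ * f (ε ^ n) := by
    obtain ⟨n, hn | hn⟩ := isFundamental_pell_407.eq_zpow_or_neg_zpow u
    · exact ⟨1, n, by simp, by rw [hn, one_mul]⟩
    · exact ⟨-1, n, by simp, by rw [hn, hfneg]; ring⟩
  obtain ⟨q, ρ, hq, hρ⟩ : ∃ q ρ : ℤ, n = ρ + 3 * q ∧ (ρ = 0 ∨ ρ = -1 ∨ ρ = 1) :=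
    ⟨(n + 1) / 3, n - 3 * ((n + 1) / 3), by ring, by omega⟩
  have hinv : f u * (σ * f (ε ^ (-q)) ^ 3 * f (ε ^ (-ρ))) = 1 := by
    rw [hn, ← map_pow, show σ * f (ε ^ n) * (σ * f ((ε ^ (-q)) ^ 3) * f (ε ^ (-ρ))) =
      σ ^ 2 * (f (ε ^ n) * f ((ε ^ (-q)) ^ 3) * f (ε ^ (-ρ))) by ring, hσ, one_mul, ← map_mul,
      ← map_mul, ← zpow_natCast, ← zpow_mul, ← zpow_add, ← zpow_add, hq]
    convert map_one f
    convert zpow_zero ε using 2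
    push_cast
    ring
  refine ⟨γ * σ * f (ε ^ (-q)), f (ε ^ (-ρ)), ?_, ?_⟩
  · rcases hρ with rfl | rfl | rfl
    · left; rfl
    · right; left; rfl
    · right; right; rfl
  · linear_combination (-⟨a, b⟩ : ℤ√407) * hinv - σ ^ 3 * f (ε ^ (-q)) ^ 3 * f (ε ^ (-ρ)) * h1
      + (-⟨a, b⟩ * f u * σ * f (ε ^ (-q)) ^ 3 * f (ε ^ (-ρ)) : ℤ√407) * hσ

theorem exists_eq_cube_of_sq_sub_eq_cube {a b x : ℤ} (hab : IsCoprime a b) (hx : x ≠ 0)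
    (h : a ^ 2 - 407 * b ^ 2 = x ^ 3) (h9 : 9 ∣ b) :
    ∃ m n : ℤ, a = m ^ 3 + 1221 * m * n ^ 2 ∧ b = 3 * m ^ 2 * n + 407 * n ^ 3 := by
  obtain ⟨⟨m, n⟩, η, hη, hg⟩ := exists_eq_cube_mul_of_sq_sub_eq_cube hab hx h
  have h3 : Prime (3 : ℤ) := Int.prime_three
  have key : ∀ e : ℤ, a = 2663 * (m ^ 3 + 1221 * m * n ^ 2) + 407 * (3 * e) *
      (3 * m ^ 2 * n + 407 * n ^ 3) → b = 2663 * (3 * m ^ 2 * n + 407 * n ^ 3) + 3 * e *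
      (m ^ 3 + 1221 * m * n ^ 2) → IsCoprime 3 e → False := by
    intro e ha hb he
    obtain ⟨c, rfl⟩ := h9
    have hn : 3 ∣ n := h3.dvd_of_dvd_pow (n := 3) ⟨3 * c - 2663 * m ^ 2 * n - e *
      (m ^ 3 + 1221 * m * n ^ 2) - 361280 * n ^ 3, by linear_combination -hb⟩
    obtain ⟨n, rfl⟩ := hn
    have hm : 3 ∣ e * m ^ 3 := ⟨c - 2663 * (m ^ 2 * n + 407 * 3 * n ^ 3) - e * 1221 * m * 3 * n ^ 2,
      by linarith⟩
    obtain ⟨m, rfl⟩ := h3.dvd_of_dvd_pow (he.dvd_of_dvd_mul_left hm)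
    have h3a : (3 : ℤ) ∣ a := by
      rw [ha]
      exact ⟨2663 * (9 * m ^ 3 + 1221 * 9 * m * n ^ 2) + 407 * e *
        (81 * m ^ 2 * n + 407 * 27 * n ^ 3), by ring⟩
    exact h3.not_isUnit (hab.isUnit_of_dvd' h3a ⟨3 * c, by ring⟩)
  have e1 := congrArg Zsqrtd.re hg
  have e2 := congrArg Zsqrtd.im hg
  rcases hη with rfl | rfl | rfl
  · simp [pow_succ] at e1 e2
    exact ⟨m, n, by linarith, by linarith⟩
  · simp [pow_succ] at e1 e2
    exact (key 44 (by linarith) (by linarith) (by norm_num)).elim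
  · simp [pow_succ] at e1 e2
    exact (key (-44) (by linarith) (by linarith) (by norm_num)).elim

theorem sq_add_ne_cube_of_isCoprime_descent {x y z : ℤ} (hz : z ≠ 0) (hyz : IsCoprime y z)
    (h : y ^ 2 + 1221 * z ^ 6 = x ^ 3) :
    ∃ x' y' z' : ℤ, z' ≠ 0 ∧ z'.natAbs < z.natAbs ∧ y' ^ 2 + 1221 * z' ^ 6 = x' ^ 3 := by
  have h3 : Prime (3 : ℤ) := Int.prime_three
  obtain ⟨m, n, hy, hzmn⟩ := exists_eq_cube_of_sq_add_eq_cube (hyz.pow_right (n := 3))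
    (x := x) (by linear_combination h)
  have hmn : IsCoprime m n := by
    have hc := hyz.pow_right (n := 3)
    rw [hy, hzmn, show m ^ 3 - 3663 * m * n ^ 2 = m * (m ^ 2 - 3663 * n ^ 2) by ring,
      show 3 * m ^ 2 * n - 1221 * n ^ 3 = n * (3 * m ^ 2 - 1221 * n ^ 2) by ring] at hc
    exact hc.of_mul_left_left.of_mul_right_left
  obtain ⟨w, rfl⟩ : 3 ∣ z := h3.dvd_of_dvd_pow (n := 3)
    ⟨m ^ 2 * n - 407 * n ^ 3, by linear_combination hzmn⟩
  have hw : 9 * w ^ 3 = n * (m ^ 2 - 407 * n ^ 2) := by linarith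
  have h3' : ¬ (3 : ℤ) ∣ m ^ 2 - 407 * n ^ 2 := by
    intro hd
    have hd' : ((m ^ 2 - 407 * n ^ 2 : ℤ) : ZMod 3) = 0 :=
      (ZMod.intCast_zmod_eq_zero_iff_dvd _ 3).2 hd
    push_cast at hd'
    rw [show (407 : ZMod 3) = 2 from rfl] at hd'
    have hz : ∀ u v : ZMod 3, u ^ 2 - 2 * v ^ 2 = 0 → u = 0 ∧ v = 0 := by decide
    obtain ⟨hu, hv⟩ := hz _ _ hd'
    exact h3.not_isUnit (hmn.isUnit_of_dvd' ((ZMod.intCast_zmod_eq_zero_iff_dvd m 3).1 hu)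
      ((ZMod.intCast_zmod_eq_zero_iff_dvd n 3).1 hv))
  have h9 : IsCoprime (9 : ℤ) (m ^ 2 - 407 * n ^ 2) := by
    rw [show (9 : ℤ) = 3 ^ 2 by norm_num]
    exact ((h3.irreducible.coprime_iff_not_dvd).2 h3').pow_left
  obtain ⟨k, rfl⟩ := h9.dvd_of_dvd_mul_right ⟨w ^ 3, hw.symm⟩
  have hk : k * (m ^ 2 - 407 * (9 * k) ^ 2) = w ^ 3 := by linarith
  have hmk : IsCoprime m k := hmn.of_mul_right_right
  have hcop : IsCoprime k (m ^ 2 - 407 * (9 * k) ^ 2) := by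
    have := (hmk.symm.pow_right (n := 2)).add_mul_left_right (-407 * 81 * k)
    rwa [show m ^ 2 + k * (-407 * 81 * k) = m ^ 2 - 407 * (9 * k) ^ 2 by ring] at this
  obtain ⟨⟨c, rfl⟩, d, hd⟩ := Int.eq_pow_of_mul_eq_pow_odd hcop (by decide) hk
  have hwcd : w = c * d := (Odd.strictMono_pow (n := 3) (by decide)).injective (by
    rw [← hk, hd]; ring)
  subst hwcd
  have hc0 : c ≠ 0 := by rintro rfl; simp at hz
  have hd0 : d ≠ 0 := by rintro rfl; simp at hz
  obtain ⟨g, j, hm, hj⟩ := exists_eq_cube_of_sq_sub_eq_cube hmn hd0 hd (Dvd.intro _ rfl)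
  obtain ⟨j, rfl⟩ : 3 ∣ j := h3.dvd_of_dvd_pow (n := 3)
    ⟨136 * j ^ 3 - 3 * c ^ 3 + g ^ 2 * j, by linear_combination hj⟩
  have hcj : j * (g ^ 2 + 1221 * j ^ 2) = c ^ 3 := by linarith
  have hgj : IsCoprime g j := by
    rw [hm, hj, show g ^ 3 + 1221 * g * (3 * j) ^ 2 = g * (g ^ 2 + 1221 * (3 * j) ^ 2) by ring,
      show 3 * g ^ 2 * (3 * j) + 407 * (3 * j) ^ 3 = j * (9 * g ^ 2 + 407 * 27 * j ^ 2) by ring]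
      at hmn
    exact hmn.of_mul_left_left.of_mul_right_left
  have hcop' : IsCoprime j (g ^ 2 + 1221 * j ^ 2) := by
    have := (hgj.symm.pow_right (n := 2)).add_mul_left_right (1221 * j)
    rwa [show g ^ 2 + j * (1221 * j) = g ^ 2 + 1221 * j ^ 2 by ring] at this
  obtain ⟨⟨f, rfl⟩, e, he⟩ := Int.eq_pow_of_mul_eq_pow_odd hcop' (by decide) hcj
  have hcfe : c = f * e := (Odd.strictMono_pow (n := 3) (by decide)).injective (by
    rw [← hcj, he]; ring)
  subst hcfe
  refine ⟨e, g, f, left_ne_zero_of_mul hc0, ?_, by linear_combination he⟩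
  have hf : 0 < f.natAbs := Int.natAbs_pos.2 (left_ne_zero_of_mul hc0)
  have hed : 0 < e.natAbs * d.natAbs :=
    Nat.mul_pos (Int.natAbs_pos.2 (right_ne_zero_of_mul hc0)) (Int.natAbs_pos.2 hd0)
  rw [Int.natAbs_mul, Int.natAbs_mul, Int.natAbs_mul, mul_assoc, show (3 : ℤ).natAbs = 3 from rfl]
  nlinarith

theorem sq_add_ne_cube {x y z : ℤ} (hz : z ≠ 0) : y ^ 2 + 1221 * z ^ 6 ≠ x ^ 3 := by
  intro h
  induction hn : z.natAbs using Nat.strong_induction_on generalizing x y z with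
  | _ n ih =>
  subst hn
  by_cases hyz : IsCoprime y z
  · obtain ⟨x', y', z', h0, hlt, h'⟩ := sq_add_ne_cube_of_isCoprime_descent hz hyz h
    exact ih _ hlt h0 h' rfl
  · obtain ⟨p, hp, ⟨y, rfl⟩, ⟨z, rfl⟩⟩ : ∃ p : ℤ, Prime p ∧ p ∣ y ∧ p ∣ z := by
      by_contra! H
      exact hyz (isCoprime_of_prime_dvd (fun h0 => hz h0.2) H)
    have hp0 := hp.ne_zero
    obtain ⟨x, rfl⟩ : p ∣ x := hp.dvd_of_dvd_pow (n := 3)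
      ⟨p * y ^ 2 + 1221 * p ^ 5 * z ^ 6, by linear_combination -h⟩
    obtain ⟨y, rfl⟩ : p ∣ y := hp.dvd_of_dvd_pow (n := 2)
      ⟨x ^ 3 - 1221 * p ^ 3 * z ^ 6, mul_left_cancel₀ (pow_ne_zero 2 hp0)
        (by linear_combination h)⟩
    obtain ⟨x, rfl⟩ : p ∣ x := hp.dvd_of_dvd_pow (n := 3)
      ⟨y ^ 2 + 1221 * p ^ 2 * z ^ 6, mul_left_cancel₀ (pow_ne_zero 3 hp0)
        (by linear_combination -h)⟩
    obtain ⟨y, rfl⟩ : p ∣ y := hp.dvd_of_dvd_pow (n := 2)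
      ⟨p * x ^ 3 - 1221 * p * z ^ 6, mul_left_cancel₀ (pow_ne_zero 4 hp0)
        (by linear_combination h)⟩
    have hz0 := right_ne_zero_of_mul hz
    refine ih z.natAbs ?_ (x := x) (y := y) hz0
      (mul_left_cancel₀ (pow_ne_zero 6 hp0) (by linear_combination h)) rfl
    rw [Int.natAbs_mul]
    have h2 : 2 ≤ p.natAbs := (Int.prime_iff_natAbs_prime.1 hp).two_le
    have := Int.natAbs_pos.2 hz0
    nlinarith

theorem rat_sq_ne_cube_sub (X Y : ℚ) : Y ^ 2 ≠ X ^ 3 - 1221 := by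
  intro h
  refine sq_add_ne_cube (z := X.den * Y.den) (x := X.num * X.den * Y.den ^ 2)
    (y := Y.num * Y.den ^ 2 * X.den ^ 3) (by simp) ?_
  have hX : (X.den : ℚ) ≠ 0 := by simp
  have hY : (Y.den : ℚ) ≠ 0 := by simp
  rw [← Rat.num_div_den X, ← Rat.num_div_den Y] at h
  field_simp at h
  have : ((Y.num : ℚ) * Y.den ^ 2 * X.den ^ 3) ^ 2 + 1221 * (X.den * Y.den) ^ 6 =
      (X.num * X.den * Y.den ^ 2) ^ 3 := by
    linear_combination X.den ^ 3 * Y.den ^ 4 * h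
  exact_mod_cast this

theorem quartic_ne_zero (t : ℚ) : t ^ 4 - 54 * t ^ 2 - 117 * t - 243 ≠ 0 := by
  intro h
  have hd : (t.den : ℚ) ≠ 0 := by simp
  rw [← Rat.num_div_den t] at h
  field_simp at h
  have h' : t.num ^ 4 - 54 * t.num ^ 2 * t.den ^ 2 - 117 * t.num * t.den ^ 3
      - 243 * (t.den : ℤ) ^ 4 = 0 := by
    have : (t.num : ℚ) ^ 4 - 54 * t.num ^ 2 * t.den ^ 2 - 117 * t.num * t.den ^ 3
      - 243 * t.den ^ 4 = 0 := by linear_combination h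
    exact_mod_cast this
  have h2 := congrArg (Int.cast : ℤ → ZMod 2) h'
  push_cast at h2
  rw [show (54 : ZMod 2) = 0 from rfl, show (117 : ZMod 2) = 1 from rfl,
    show (243 : ZMod 2) = 1 from rfl] at h2
  have key : ∀ u v : ZMod 2, u ^ 4 - 0 * u ^ 2 * v ^ 2 - 1 * u * v ^ 3 - 1 * v ^ 4 = 0 →
      u = 0 ∧ v = 0 := by decide
  obtain ⟨hu, hv⟩ := key _ _ h2
  have hu' : 2 ∣ t.num.natAbs := by
    rw [← Int.natCast_dvd]
    exact (ZMod.intCast_zmod_eq_zero_iff_dvd _ 2).1 hu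
  exact Nat.not_coprime_of_dvd_of_dvd one_lt_two hu' ((ZMod.natCast_eq_zero_iff _ 2).1 hv) t.reduced

theorem statement_8 :
    ¬ ∃ u t : ℚ, u ^ 2 = 3 * (t ^ 4 - 54 * t ^ 2 - 117 * t - 243) := by
  rintro ⟨u, t, h⟩
  have hu : u ≠ 0 := by
    rintro rfl
    exact quartic_ne_zero t (by linarith)
  set G := 36 * t ^ 4 + 234 * t ^ 3 + 1944 * t ^ 2 + 2106 * t - 21303 / 4 with hG
  set J := 117 * t ^ 6 + 3888 * t ^ 5 + 15795 * t ^ 4 + 68445 / 2 * t ^ 3 + 142155 * t ^ 2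
    + 1519965 / 2 * t + 4539483 / 8 with hJ
  have hsyz : J ^ 2 = G ^ 3 - 1221 * (u ^ 2) ^ 3 := by
    rw [h, hG, hJ]; ring
  refine rat_sq_ne_cube_sub (G / u ^ 2) (J / u ^ 3) ?_
  field_simp
  linear_combination hsyz
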